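/- Let (Λ,η) be an isothermic surface in S³ with lift F : Σ → E(w) in a 3-dimensional space-form E(w) of sectional curvature K = −(w,w), with conformal curvature line coordinates (u,v) corresponding to η, conformal factor e^{2θ}, principal curvatures k₁, k₂, H = (k₁+k₂)/2, L = e^{2θ}(k₁−k₂), M = −HL. If (Λ,η) is special isothermic of type 2 in E(w), then there exist real constants A, B, C, D such that the Darboux–Bianchi condition e^{2θ}(H_u² + H_v²) + (1/4)M² + AM − 2BH + CL + D + (1/4)L²K = 0 holds. Conversely, if H_u H_v is nowhere zero on Σ and the Darboux–Bianchi condition holds for some real constants A, B, C, D, then (Λ,η) is special isothermic of type 2 in E(w). -/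

import Mathlib

noncomputable section

open Finset

/-- Minkowski space `ℝ^{n+1,1}`, modelled on `Fin (n+2) → ℝ`. -/
abbrev MV (n : ℕ) : Type := EuclideanSpace ℝ (Fin (n + 2))

/-- The Minkowski inner product of signature `(n+1,1)`. -/
def mink (n : ℕ) (x y : MV n) : ℝ :=
  ∑ i : Fin (n + 1), x i.castSucc * y i.castSucc
    - x (Fin.last (n + 1)) * y (Fin.last (n + 1))

/-- The light cone `L ⊂ ℝ^{n+1,1}`. -/
def LightCone (n : ℕ) : Set (MV n) := {v | v ≠ 0 ∧ mink n v v = 0}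

/-- The skew endomorphism `u ∧ v`, acting by `(u ∧ v) w = (u,w)v − (v,w)u`. -/
def wedge (n : ℕ) (u v w : MV n) : MV n :=
  mink n u w • v - mink n v w • u

/-- The surface domain: a two-dimensional coordinate chart. -/
abbrev Surf : Type := ℝ × ℝ

/-- the coordinate direction ∂/∂u -/
def du : Surf := (1, 0)

/-- the coordinate direction ∂/∂v -/
def dv : Surf := (0, 1)

/-- partial derivative of a section in a coordinate direction -/
def pd {n : ℕ} (e : Surf) (f : Surf → MV n) (x : Surf) : MV n :=
  fderiv ℝ f x e

lemma mink_add_left (n : ℕ) (a b c : MV n) :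
    mink n (a + b) c = mink n a c + mink n b c := by
  simp [mink, PiLp.add_apply, add_mul, Finset.sum_add_distrib]; ring

lemma mink_smul_left (n : ℕ) (r : ℝ) (a c : MV n) :
    mink n (r • a) c = r * mink n a c := by
  simp [mink, PiLp.smul_apply, smul_eq_mul, mul_sub, Finset.mul_sum, mul_assoc]

lemma mink_zero_left (n : ℕ) (c : MV n) : mink n 0 c = 0 := by
  simp [mink]

/-- An isothermic surface `(Λ,η)` in `S^n = P(L)`, given by a nowhere-zero null
lift `F` of the immersion `Λ` together with the 1-form
`η = F ∧ W₁ du + F ∧ W₂ dv` with values in `Λ ∧ Λ^⊥`. -/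
structure IsothermicSurface (n : ℕ) : Type where
  F : Surf → MV n
  W₁ : Surf → MV n
  W₂ : Surf → MV n
  smooth_F : ContDiff ℝ (⊤ : ℕ∞) F
  smooth_W₁ : ContDiff ℝ (⊤ : ℕ∞) W₁
  smooth_W₂ : ContDiff ℝ (⊤ : ℕ∞) W₂
  F_ne : ∀ x, F x ≠ 0
  F_null : ∀ x, mink n (F x) (F x) = 0
  immersed : ∀ x, LinearIndependent ℝ ![F x, pd du F x, pd dv F x]
  W₁_perp : ∀ x, mink n (F x) (W₁ x) = 0
  W₂_perp : ∀ x, mink n (F x) (W₂ x) = 0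
  eta_ne : ∃ x z, wedge n (F x) (W₁ x) z ≠ 0 ∨ wedge n (F x) (W₂ x) z ≠ 0
  eta_closed : ∀ x z,
    fderiv ℝ (fun y => wedge n (F y) (W₂ y) z) x du
      = fderiv ℝ (fun y => wedge n (F y) (W₁ y) z) x dv

/-- `s` is a parallel section for the flat connection `∇^t = d + tη`. -/
def ParallelSection (n : ℕ) (S : IsothermicSurface n) (t : ℝ)
    (s : Surf → MV n) : Prop :=
  ∀ x, fderiv ℝ s x du + t • wedge n (S.F x) (S.W₁ x) (s x) = 0
     ∧ fderiv ℝ s x dv + t • wedge n (S.F x) (S.W₂ x) (s x) = 0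

/-- A polynomial conserved quantity of degree `d` of the isothermic surface
`(Λ,η)`: a polynomial `p(t) = Σ_{k=0}^d p_k t^k` of (smooth) sections, of exact
degree `d`, with `∇^t p(t) = 0` for all `t`. -/
structure PolyConservedQuantity (n : ℕ) (S : IsothermicSurface n) (d : ℕ) : Type where
  coeff : ℕ → Surf → MV n
  smooth : ∀ k, ContDiff ℝ (⊤ : ℕ∞) (coeff k)
  coeff_eq_zero : ∀ k, d < k → coeff k = 0
  top_ne : coeff d ≠ 0
  conserved : ∀ t : ℝ, ParallelSection n S t
    (fun x => ∑ k ∈ Finset.range (d + 1), t ^ k • coeff k x)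

/-- evaluation `p(t)` of a polynomial conserved quantity -/
def pcEval {n : ℕ} {S : IsothermicSurface n} {d : ℕ}
    (p : PolyConservedQuantity n S d) (t : ℝ) (x : Surf) : MV n :=
  ∑ k ∈ Finset.range (d + 1), t ^ k • p.coeff k x

/-- `(Λ,η)` is a special isothermic surface of type `d`. -/
def SpecialOfType (n : ℕ) (S : IsothermicSurface n) (d : ℕ) : Prop :=
  Nonempty (PolyConservedQuantity n S d)

/-- `p₀ ∈ ⟨w⟩`: the polynomial conserved quantity exhibits `(Λ,η)` as special
isothermic in the space-form `E(w)`. -/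
def InSpaceForm {n : ℕ} {S : IsothermicSurface n} {d : ℕ}
    (p : PolyConservedQuantity n S d) (w : MV n) : Prop :=
  ∃ c : ℝ, ∀ x, p.coeff 0 x = c • w

/-- fullness: the image of `Λ` lies in no proper subsphere -/
def Full (n : ℕ) (S : IsothermicSurface n) : Prop :=
  ¬ ∃ p : MV n, p ≠ 0 ∧ ∀ x, mink n p (S.F x) = 0
/-- A Darboux transform `Λ̂` of `(Λ,η)` with parameter `m`, given by a
`∇^m`-parallel null lift `G` spanning an immersed surface with `Λ̂ ∩ Λ = 0`. -/
structure DarbouxTransform (n : ℕ) (S : IsothermicSurface n) (m : ℝ) : Type where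
  G : Surf → MV n
  smooth_G : ContDiff ℝ (⊤ : ℕ∞) G
  G_ne : ∀ x, G x ≠ 0
  G_null : ∀ x, mink n (G x) (G x) = 0
  immersed : ∀ x, LinearIndependent ℝ ![G x, pd du G x, pd dv G x]
  disjoint : ∀ x, G x ∉ Submodule.span ℝ {S.F x}
  parallel : ParallelSection n S m G

/-- The gauge transformation `Γ_{⟨F⟩}^{⟨G⟩}(c)`: acts as `c` on `⟨G⟩`, as `1` on
`(⟨F⟩ ⊕ ⟨G⟩)^⊥` and as `c⁻¹` on `⟨F⟩`. -/
def gaugeG (n : ℕ) (F G : MV n) (c : ℝ) (z : MV n) : MV n :=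
  ((mink n G z / mink n F G) / c) • F
    + (c * (mink n F z / mink n F G)) • G
    + (z - (mink n G z / mink n F G) • F - (mink n F z / mink n F G) • G)

/-- `Γ_Λ^{Λ̂}(1 − t/m) · (d + tη) = d + tη̂` for all `t ≠ m`: the gauge relation
between the pencils of flat connections of an isothermic surface `S` and of (an
isothermic structure `T` on) its Darboux transform with parameter `m`. -/
def GaugeRel (n : ℕ) (S T : IsothermicSurface n) (m : ℝ) : Prop :=
  ∀ t : ℝ, t ≠ m → ∀ s : Surf → MV n, ContDiff ℝ (⊤ : ℕ∞) s → ∀ x : Surf,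
    (fderiv ℝ (fun y => gaugeG n (S.F y) (T.F y) (1 - t / m) (s y)) x du
        + t • wedge n (T.F x) (T.W₁ x) (gaugeG n (S.F x) (T.F x) (1 - t / m) (s x))
      = gaugeG n (S.F x) (T.F x) (1 - t / m)
          (fderiv ℝ s x du + t • wedge n (S.F x) (S.W₁ x) (s x)))
    ∧ (fderiv ℝ (fun y => gaugeG n (S.F y) (T.F y) (1 - t / m) (s y)) x dv
        + t • wedge n (T.F x) (T.W₂ x) (gaugeG n (S.F x) (T.F x) (1 - t / m) (s x))
      = gaugeG n (S.F x) (T.F x) (1 - t / m)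
          (fderiv ℝ s x dv + t • wedge n (S.F x) (S.W₂ x) (s x)))

/-- `Λ̂ = ⟨p(m)⟩` with `(p(m),p(m)) = 0`: the Darboux transform `D` is a
complementary surface of `(Λ,η)` with respect to `p(t)`. -/
def IsComplementary (n : ℕ) {S : IsothermicSurface n} {d : ℕ}
    (p : PolyConservedQuantity n S d) {m : ℝ} (D : DarbouxTransform n S m) : Prop :=
  (∀ x, mink n (pcEval p m x) (pcEval p m x) = 0) ∧
  (∀ x, Submodule.span ℝ {D.G x} = Submodule.span ℝ {pcEval p m x})

/-- `m` is a repeated root of the (constant-coefficient) polynomial `(p(t),p(t))`. -/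
def IsRepeatedRootAt {n : ℕ} {S : IsothermicSurface n} {d : ℕ}
    (p : PolyConservedQuantity n S d) (m : ℝ) : Prop :=
  ∀ x, mink n (pcEval p m x) (pcEval p m x) = 0
    ∧ deriv (fun t : ℝ => mink n (pcEval p t x) (pcEval p t x)) m = 0
/-- metric coefficient `g₁₁ = (F_u,F_u)` of the induced metric -/
def gUU (n : ℕ) (F : Surf → MV n) (x : Surf) : ℝ := mink n (pd du F x) (pd du F x)

/-- metric coefficient `g₁₂ = (F_u,F_v)` -/
def gUV (n : ℕ) (F : Surf → MV n) (x : Surf) : ℝ := mink n (pd du F x) (pd dv F x)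

/-- metric coefficient `g₂₂ = (F_v,F_v)` -/
def gVV (n : ℕ) (F : Surf → MV n) (x : Surf) : ℝ := mink n (pd dv F x) (pd dv F x)

/-- `(𝐇, N)`, the inner product of the mean curvature vector of `F` (in a
space-form `E(w)`) with a normal field `N`: half the trace with respect to the
induced metric of the `N`-component of the second fundamental form. -/
def meanCurv (n : ℕ) (F N : Surf → MV n) (x : Surf) : ℝ :=
  (gVV n F x * mink n (pd du (pd du F) x) (N x)
    - 2 * gUV n F x * mink n (pd du (pd dv F) x) (N x)
    + gUU n F x * mink n (pd dv (pd dv F) x) (N x))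
  / (2 * (gUU n F x * gVV n F x - gUV n F x ^ 2))

/-- `N` is a unit normal field of the lift `F : Σ → E(w)`. -/
def IsUnitNormal (n : ℕ) (F N : Surf → MV n) (w : MV n) : Prop :=
  (∀ x, mink n (N x) (N x) = 1) ∧ (∀ x, mink n (N x) w = 0)
    ∧ (∀ x, mink n (N x) (F x) = 0)
    ∧ (∀ x, mink n (N x) (pd du F x) = 0) ∧ (∀ x, mink n (N x) (pd dv F x) = 0)

/-- `N` is parallel for the normal connection of `F : Σ → E(w)`: the derivative
of `N` has no component in the normal bundle of `F` in `E(w)`. -/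
def ParallelNormal (n : ℕ) (F N : Surf → MV n) (w : MV n) : Prop :=
  ∀ x e, fderiv ℝ N x e ∈ Submodule.span ℝ {F x, pd du F x, pd dv F x, w}

/-- the chart coordinates `(u,v)` are conformal curvature line coordinates
corresponding to `η`, with conformal factor `e^{2θ}`:
`I = e^{2θ}(du² + dv²)` and `η = e^{−2θ} F ∧ (−F_u du + F_v dv)`. -/
def ConformalCoords (n : ℕ) (S : IsothermicSurface n) (θ : Surf → ℝ) : Prop :=
  ContDiff ℝ (⊤ : ℕ∞) θ
  ∧ (∀ x, mink n (pd du S.F x) (pd du S.F x) = Real.exp (2 * θ x))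
  ∧ (∀ x, mink n (pd dv S.F x) (pd dv S.F x) = Real.exp (2 * θ x))
  ∧ (∀ x, mink n (pd du S.F x) (pd dv S.F x) = 0)
  ∧ (∀ x z, wedge n (S.F x) (S.W₁ x) z
      = Real.exp (-(2 * θ x)) • wedge n (S.F x) (-pd du S.F x) z)
  ∧ (∀ x z, wedge n (S.F x) (S.W₂ x) z
      = Real.exp (-(2 * θ x)) • wedge n (S.F x) (pd dv S.F x) z)

/-- the second fundamental form of the lift `F` in `E(w)` with respect to the
unit normal `N` is `II = e^{2θ}(k₁ du² + k₂ dv²)`. -/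
def PrincipalCurvatures (n : ℕ) (S : IsothermicSurface n) (N : Surf → MV n)
    (θ k₁ k₂ : Surf → ℝ) : Prop :=
  (∀ x, mink n (pd du (pd du S.F) x) (N x) = Real.exp (2 * θ x) * k₁ x)
  ∧ (∀ x, mink n (pd du (pd dv S.F) x) (N x) = 0)
  ∧ (∀ x, mink n (pd dv (pd dv S.F) x) (N x) = Real.exp (2 * θ x) * k₂ x)

/-- partial derivative of a real function on the surface -/
def pdR (e : Surf) (f : Surf → ℝ) (x : Surf) : ℝ := fderiv ℝ f x e
/-- `(Λ^c, η^c)` is the Christoffel transform of `(Λ,η)` with respect to the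
pair `(v∞, v₀)`, witnessed by the stereoprojections `f`, `f^c` into
`ℝ^n = ⟨v₀,v∞⟩^⊥`:  `F = exp(f ∧ v∞)v₀`, `F^c = exp(f^c ∧ v₀)v∞`,
`η = Ad(exp(f ∧ v∞))(df^c ∧ v₀)` and `η^c = Ad(exp(f^c ∧ v₀))(df ∧ v∞)`. -/
def IsChristoffelPair (n : ℕ) (S Sc : IsothermicSurface n) (vinf v0 : MV n)
    (f fc : Surf → MV n) : Prop :=
  vinf ∈ LightCone n ∧ v0 ∈ LightCone n ∧ mink n v0 vinf = -1
  ∧ ContDiff ℝ (⊤ : ℕ∞) f ∧ ContDiff ℝ (⊤ : ℕ∞) fc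
  ∧ (∀ x, mink n (f x) v0 = 0) ∧ (∀ x, mink n (f x) vinf = 0)
  ∧ (∀ x, mink n (fc x) v0 = 0) ∧ (∀ x, mink n (fc x) vinf = 0)
  ∧ (∀ x, S.F x = v0 + f x + (mink n (f x) (f x) / 2) • vinf)
  ∧ (∀ x, Sc.F x = vinf + fc x + (mink n (fc x) (fc x) / 2) • v0)
  ∧ (∀ x z, wedge n (S.F x) (S.W₁ x) z
      = wedge n (pd du fc x + mink n (f x) (pd du fc x) • vinf) (S.F x) z)
  ∧ (∀ x z, wedge n (S.F x) (S.W₂ x) z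
      = wedge n (pd dv fc x + mink n (f x) (pd dv fc x) • vinf) (S.F x) z)
  ∧ (∀ x z, wedge n (Sc.F x) (Sc.W₁ x) z
      = wedge n (pd du f x + mink n (fc x) (pd du f x) • v0) (Sc.F x) z)
  ∧ (∀ x z, wedge n (Sc.F x) (Sc.W₂ x) z
      = wedge n (pd dv f x + mink n (fc x) (pd dv f x) • v0) (Sc.F x) z)

/-- `Φ` is an orthogonal gauge transformation with `Φ · (d + sη) = d`. -/
def IsTGauge (n : ℕ) (S : IsothermicSurface n) (s : ℝ)
    (Φ : Surf → MV n → MV n) : Prop :=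
  (∀ x, IsLinearMap ℝ (Φ x))
  ∧ (∀ x z z', mink n (Φ x z) (Φ x z') = mink n z z')
  ∧ (∀ σ : Surf → MV n, ContDiff ℝ (⊤ : ℕ∞) σ → ∀ x,
      (fderiv ℝ (fun y => Φ y (σ y)) x du
         = Φ x (fderiv ℝ σ x du + s • wedge n (S.F x) (S.W₁ x) (σ x)))
      ∧ (fderiv ℝ (fun y => Φ y (σ y)) x dv
         = Φ x (fderiv ℝ σ x dv + s • wedge n (S.F x) (S.W₂ x) (σ x))))

/-- `(Λ_s, η_s)` is the T-transform of `(Λ,η)` associated to `Φ_s`: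
`Λ_s = Φ_s Λ` and `η_s = Ad(Φ_s) η`. -/
def IsTTransform (n : ℕ) (S : IsothermicSurface n) (s : ℝ)
    (Φ : Surf → MV n → MV n) (Ss : IsothermicSurface n) : Prop :=
  IsTGauge n S s Φ
  ∧ (∀ x, Ss.F x = Φ x (S.F x))
  ∧ (∀ x z, wedge n (Ss.F x) (Ss.W₁ x) (Φ x z) = Φ x (wedge n (S.F x) (S.W₁ x) z))
  ∧ (∀ x z, wedge n (Ss.F x) (Ss.W₂ x) (Φ x z) = Φ x (wedge n (S.F x) (S.W₂ x) z))

/-- orthogonal complement with respect to the Minkowski form -/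
def mperp (n : ℕ) (U : Submodule ℝ (MV n)) : Submodule ℝ (MV n) where
  carrier := {v | ∀ u ∈ U, mink n v u = 0}
  add_mem' := by
    intro a b ha hb u hu
    rw [mink_add_left, ha u hu, hb u hu, add_zero]
  zero_mem' := by
    intro u hu; exact mink_zero_left n u
  smul_mem' := by
    intro r a ha u hu
    rw [mink_smul_left, ha u hu, mul_zero]

/-- the spherical system of `Λ` and a Darboux transform `Λ̂ = ⟨G⟩`: the
`(n−2)`-sphere congruence `C = Λ ⊕ Λ̂ ⊕ V_R^⊥`, `V_R = Λ^{(1)} ⊕ Λ̂`. -/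
def sphericalSystem (n : ℕ) (S : IsothermicSurface n) (G : Surf → MV n)
    (x : Surf) : Submodule ℝ (MV n) :=
  Submodule.span ℝ {S.F x, G x}
    ⊔ mperp n (Submodule.span ℝ {S.F x, pd du S.F x, pd dv S.F x, G x})

/-- the sphere-planes congruence `P = C + ⟨w⟩` of `Λ` and `Λ̂ = ⟨G⟩` with
respect to `w`. -/
def spherePlanes (n : ℕ) (S : IsothermicSurface n) (G : Surf → MV n)
    (w : MV n) (x : Surf) : Submodule ℝ (MV n) :=
  sphericalSystem n S G x ⊔ Submodule.span ℝ {w}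
/-- the mean curvature `H = (k₁+k₂)/2` -/
def Hfun (k₁ k₂ : Surf → ℝ) : Surf → ℝ := fun x => (k₁ x + k₂ x) / 2

/-- `L = e^{2θ}(k₁ − k₂)` -/
def Lfun (θ k₁ k₂ : Surf → ℝ) : Surf → ℝ :=
  fun x => Real.exp (2 * θ x) * (k₁ x - k₂ x)

/-- `M = −HL` -/
def Mfun (θ k₁ k₂ : Surf → ℝ) : Surf → ℝ :=
  fun x => -(Hfun k₁ k₂ x * Lfun θ k₁ k₂ x)
/-- the Darboux–Bianchi condition
`e^{2θ}(H_u² + H_v²) + ¼M² + AM − 2BH + CL + D + ¼L²K = 0`, `K = −(w,w)`. -/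
def DarbouxBianchi (w : MV 3) (θ k₁ k₂ : Surf → ℝ) (A B C D : ℝ) : Prop :=
  ∀ x : Surf,
    Real.exp (2 * θ x) * (pdR du (Hfun k₁ k₂) x ^ 2 + pdR dv (Hfun k₁ k₂) x ^ 2)
      + (1 / 4) * Mfun θ k₁ k₂ x ^ 2 + A * Mfun θ k₁ k₂ x
      - 2 * B * Hfun k₁ k₂ x + C * Lfun θ k₁ k₂ x + D
      + (1 / 4) * Lfun θ k₁ k₂ x ^ 2 * (-(mink 3 w w)) = 0

section Calculus

variable {V : Type*} [NormedAddCommGroup V] [NormedSpace ℝ V]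

lemma contDiff_fderiv_apply {f : Surf → V} (hf : ContDiff ℝ (⊤ : ℕ∞) f) (e : Surf) :
    ContDiff ℝ (⊤ : ℕ∞) (fun x => fderiv ℝ f x e) :=
  (hf.fderiv_right (m := ((⊤ : ℕ∞) : WithTop ℕ∞)) (by exact_mod_cast le_rfl)).clm_apply
    contDiff_const

lemma fderiv_fderiv_comm {f : Surf → V} (hf : ContDiff ℝ (⊤ : ℕ∞) f) (a b x : Surf) :
    fderiv ℝ (fun y => fderiv ℝ f y a) x b = fderiv ℝ (fun y => fderiv ℝ f y b) x a := by
  have hd : DifferentiableAt ℝ (fderiv ℝ f) x :=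
    ((hf.fderiv_right (m := 1) (by norm_cast)).differentiable one_ne_zero) x
  have happly : ∀ c d : Surf,
      fderiv ℝ (fun y => fderiv ℝ f y c) x d = fderiv ℝ (fderiv ℝ f) x d c := by
    intro c d
    rw [fderiv_clm_apply hd (differentiableAt_const c)]
    simp
  rw [happly, happly]
  exact (hf.contDiffAt.isSymmSndFDerivAt (by
    rw [minSmoothness_of_isRCLikeNormedField]
    exact WithTop.coe_le_coe.mpr (le_top : (2 : ℕ∞) ≤ ⊤))) b a

lemma eq_const_of_fderiv_du_dv_eq_zero {f : Surf → ℝ} (hf : ContDiff ℝ (⊤ : ℕ∞) f)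
    (hu : ∀ x, pdR du f x = 0) (hv : ∀ x, pdR dv f x = 0) : ∃ c, ∀ x, f x = c := by
  refine ⟨f 0, fun x => is_const_of_fderiv_eq_zero (hf.differentiable (by simp)) (fun y => ?_) x 0⟩
  ext
  · exact hu y
  · exact hv y

/-- A vector-valued cubic vanishing identically has vanishing coefficients. -/
lemma cubic_coeff_eq_zero {a b c d : V}
    (h : ∀ t : ℝ, a + t • b + t ^ 2 • c + t ^ 3 • d = 0) : a = 0 ∧ b = 0 ∧ c = 0 ∧ d = 0 := by
  have h0 := h 0
  have h1 := h 1
  have h2 := h (-1)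
  have h3 := h 2
  have ha : a = 0 := by simpa using h0
  subst ha
  have hc : c = 0 := by linear_combination (norm := module) (1 / 2 : ℝ) • h1 + (1 / 2 : ℝ) • h2
  subst hc
  have hd : d = 0 := by linear_combination (norm := module) (1 / 6 : ℝ) • h3 - (1 / 3 : ℝ) • h1
  subst hd
  exact ⟨rfl, by simpa using h1, rfl, rfl⟩

end Calculus

section Minkowski

variable {n : ℕ}

lemma mink_comm (x y : MV n) : mink n x y = mink n y x := by
  simp [mink, mul_comm]

lemma mink_add_right (a b c : MV n) : mink n a (b + c) = mink n a b + mink n a c := by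
  rw [mink_comm, mink_add_left, mink_comm b, mink_comm c]

lemma mink_smul_right (r : ℝ) (a b : MV n) : mink n a (r • b) = r * mink n a b := by
  rw [mink_comm, mink_smul_left, mink_comm b]

lemma mink_neg_left (a b : MV n) : mink n (-a) b = -mink n a b := by
  rw [← neg_one_smul ℝ, mink_smul_left]; ring

lemma mink_sub_left (a b c : MV n) : mink n (a - b) c = mink n a c - mink n b c := by
  rw [sub_eq_add_neg, mink_add_left, mink_neg_left]; ring

lemma mink_zero_right (a : MV n) : mink n a 0 = 0 := by
  rw [mink_comm, mink_zero_left]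

/-- The Minkowski form as a continuous bilinear map. -/
def minkCLM (n : ℕ) : MV n →L[ℝ] MV n →L[ℝ] ℝ :=
  LinearMap.toContinuousBilinearMap (LinearMap.mk₂ ℝ (mink n) (mink_add_left n)
    (mink_smul_left n) mink_add_right mink_smul_right)

lemma minkCLM_apply (x y : MV n) : minkCLM n x y = mink n x y := rfl

lemma ContDiff.mink {f g : Surf → MV n} (hf : ContDiff ℝ (⊤ : ℕ∞) f)
    (hg : ContDiff ℝ (⊤ : ℕ∞) g) : ContDiff ℝ (⊤ : ℕ∞) (fun x => mink n (f x) (g x)) :=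
  ((minkCLM n).contDiff.comp hf).clm_apply hg

lemma pdR_mink {f g : Surf → MV n} (hf : ContDiff ℝ (⊤ : ℕ∞) f)
    (hg : ContDiff ℝ (⊤ : ℕ∞) g) (e x : Surf) :
    pdR e (fun y => mink n (f y) (g y)) x
      = mink n (pd e f x) (g x) + mink n (f x) (pd e g x) := by
  have h := (minkCLM n).fderiv_of_bilinear (hf.differentiable (by simp) x)
    (hg.differentiable (by simp) x)
  simp only [minkCLM_apply] at h
  rw [pdR, h]
  simp [minkCLM_apply, pd, add_comm]

lemma eq_zero_of_mink_eq_zero {x : MV n} (h : ∀ y, mink n x y = 0) : x = 0 := by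
  have key := h (WithLp.toLp 2 (Fin.snoc (fun i : Fin (n + 1) => x i.castSucc)
    (-x (Fin.last (n + 1)))))
  simp only [mink, Fin.snoc_castSucc, Fin.snoc_last] at key
  have hs : 0 ≤ ∑ i : Fin (n + 1), x i.castSucc * x i.castSucc :=
    sum_nonneg fun i _ => mul_self_nonneg _
  have hl : x (Fin.last (n + 1)) = 0 := by
    nlinarith [mul_self_nonneg (x (Fin.last (n + 1)))]
  have hs0 : ∑ i : Fin (n + 1), x i.castSucc * x i.castSucc = 0 := by
    nlinarith
  rw [sum_eq_zero_iff_of_nonneg fun i _ => mul_self_nonneg _] at hs0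
  ext i
  refine Fin.lastCases hl (fun j => ?_) i
  exact mul_self_eq_zero.mp (hs0 j (mem_univ j))

end Minkowski

/-- `F, P, Q, N, w` is a frame of `ℝ^{4,1}` adapted to a point `F` of `E(w)` with orthogonal
tangent vectors `P, Q` of square length `E` and unit normal `N`. -/
structure IsAdaptedFrame (F P Q N w : MV 3) (E : ℝ) : Prop where
  pos : 0 < E
  FF : mink 3 F F = 0
  FP : mink 3 F P = 0
  FQ : mink 3 F Q = 0
  FN : mink 3 F N = 0
  Fw : mink 3 F w = -1
  PP : mink 3 P P = E
  PQ : mink 3 P Q = 0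
  PN : mink 3 P N = 0
  Pw : mink 3 P w = 0
  QQ : mink 3 Q Q = E
  QN : mink 3 Q N = 0
  Qw : mink 3 Q w = 0
  NN : mink 3 N N = 1
  Nw : mink 3 N w = 0

namespace IsAdaptedFrame

variable {F P Q N w : MV 3} {E : ℝ} (h : IsAdaptedFrame F P Q N w E)
include h

lemma PF : mink 3 P F = 0 := by rw [mink_comm, h.FP]
lemma QF : mink 3 Q F = 0 := by rw [mink_comm, h.FQ]
lemma NF : mink 3 N F = 0 := by rw [mink_comm, h.FN]
lemma wF : mink 3 w F = -1 := by rw [mink_comm, h.Fw]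
lemma QP : mink 3 Q P = 0 := by rw [mink_comm, h.PQ]
lemma NP : mink 3 N P = 0 := by rw [mink_comm, h.PN]
lemma wP : mink 3 w P = 0 := by rw [mink_comm, h.Pw]
lemma NQ : mink 3 N Q = 0 := by rw [mink_comm, h.QN]
lemma wQ : mink 3 w Q = 0 := by rw [mink_comm, h.Qw]
lemma wN : mink 3 w N = 0 := by rw [mink_comm, h.Nw]

lemma linearIndependent : LinearIndependent ℝ ![F, P, Q, N, w] := by
  rw [Fintype.linearIndependent_iff]
  intro g hg
  simp only [Fin.sum_univ_five, Matrix.cons_val] at hg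
  have pair : ∀ z, g 0 * mink 3 F z + g 1 * mink 3 P z + g 2 * mink 3 Q z
      + g 3 * mink 3 N z + g 4 * mink 3 w z = 0 := by
    intro z
    have := congrArg (fun y => mink 3 y z) hg
    simpa only [mink_add_left, mink_smul_left, mink_zero_left] using this
  have hE := h.pos.ne'
  have h4 : g 4 = 0 := by simpa [h.FF, h.PF, h.QF, h.NF, h.wF] using pair F
  have h1 : g 1 = 0 := by simpa [h.FP, h.PP, h.QP, h.NP, h.wP, hE] using pair P
  have h2 : g 2 = 0 := by simpa [h.FQ, h.PQ, h.QQ, h.NQ, h.wQ, hE] using pair Q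
  have h3 : g 3 = 0 := by simpa [h.FN, h.PN, h.QN, h.NN, h.wN] using pair N
  have h0 : g 0 = 0 := by simpa [h.Fw, h.Pw, h.Qw, h.Nw, h4] using pair w
  intro i
  fin_cases i <;> assumption

lemma eq_zero {z : MV 3} (hF : mink 3 z F = 0) (hP : mink 3 z P = 0) (hQ : mink 3 z Q = 0)
    (hN : mink 3 z N = 0) (hw : mink 3 z w = 0) : z = 0 := by
  refine eq_zero_of_mink_eq_zero fun y => ?_
  have hspan := h.linearIndependent.span_eq_top_of_card_eq_finrank' (by simp)
  have hy : y ∈ Submodule.span ℝ (Set.range ![F, P, Q, N, w]) := hspan ▸ Submodule.mem_top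
  induction hy using Submodule.span_induction with
  | mem y hy =>
    obtain ⟨i, rfl⟩ := hy
    fin_cases i <;> assumption
  | zero => exact mink_zero_right z
  | add a b _ _ ha hb => rw [mink_add_right, ha, hb, add_zero]
  | smul r a _ ha => rw [mink_smul_right, ha, mul_zero]

lemma eq_of_mink_eq {y z : MV 3} (hF : mink 3 y F = mink 3 z F) (hP : mink 3 y P = mink 3 z P)
    (hQ : mink 3 y Q = mink 3 z Q) (hN : mink 3 y N = mink 3 z N)
    (hw : mink 3 y w = mink 3 z w) : y = z := by
  refine sub_eq_zero.mp (h.eq_zero ?_ ?_ ?_ ?_ ?_) <;> rw [mink_sub_left, sub_eq_zero] <;>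
    assumption

lemma expansion (z : MV 3) :
    z = -(mink 3 z w + mink 3 w w * mink 3 z F) • F + (mink 3 z P / E) • P
      + (mink 3 z Q / E) • Q + mink 3 z N • N + (-mink 3 z F) • w := by
  have hE := h.pos.ne'
  apply h.eq_of_mink_eq <;> simp only [mink_add_left, mink_smul_left, h.FF, h.FP, h.FQ, h.FN,
    h.Fw, h.PF, h.PP, h.PQ, h.PN, h.Pw, h.QF, h.QP, h.QQ, h.QN, h.Qw, h.NF, h.NP, h.NQ, h.NN,
    h.Nw, h.wF, h.wP, h.wQ, h.wN] <;> field_simp <;> ring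

lemma mink_self (z : MV 3) :
    mink 3 z z = (mink 3 z P ^ 2 + mink 3 z Q ^ 2) / E + mink 3 z N ^ 2
      - 2 * mink 3 z F * mink 3 z w - mink 3 w w * mink 3 z F ^ 2 := by
  have hE := h.pos.ne'
  have hz := congrArg (mink 3 z) (h.expansion z)
  simp only [mink_add_right, mink_smul_right] at hz
  rw [hz]
  field_simp
  ring

end IsAdaptedFrame

section PartialDerivatives

variable {n : ℕ} {a b : Surf → ℝ} {f g : Surf → MV n}

lemma contDiff_pdR (ha : ContDiff ℝ (⊤ : ℕ∞) a) (e : Surf) : ContDiff ℝ (⊤ : ℕ∞) (pdR e a) :=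
  contDiff_fderiv_apply ha e

lemma contDiff_pd (hf : ContDiff ℝ (⊤ : ℕ∞) f) (e : Surf) : ContDiff ℝ (⊤ : ℕ∞) (pd e f) :=
  contDiff_fderiv_apply hf e

lemma pdR_const (c : ℝ) (e x : Surf) : pdR e (fun _ => c) x = 0 := by simp [pdR]

lemma pdR_add (ha : ContDiff ℝ (⊤ : ℕ∞) a) (hb : ContDiff ℝ (⊤ : ℕ∞) b) (e x : Surf) :
    pdR e (fun y => a y + b y) x = pdR e a x + pdR e b x := by
  rw [pdR, fderiv_fun_add (ha.differentiable (by simp) x) (hb.differentiable (by simp) x)]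
  rfl

lemma pdR_sub (ha : ContDiff ℝ (⊤ : ℕ∞) a) (hb : ContDiff ℝ (⊤ : ℕ∞) b) (e x : Surf) :
    pdR e (fun y => a y - b y) x = pdR e a x - pdR e b x := by
  rw [pdR, fderiv_fun_sub (ha.differentiable (by simp) x) (hb.differentiable (by simp) x)]
  rfl

lemma pdR_mul (ha : ContDiff ℝ (⊤ : ℕ∞) a) (hb : ContDiff ℝ (⊤ : ℕ∞) b) (e x : Surf) :
    pdR e (fun y => a y * b y) x = pdR e a x * b x + a x * pdR e b x := by
  rw [pdR, fderiv_fun_mul (ha.differentiable (by simp) x) (hb.differentiable (by simp) x)]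
  simp [pdR]
  ring

lemma pdR_const_mul (c : ℝ) (ha : ContDiff ℝ (⊤ : ℕ∞) a) (e x : Surf) :
    pdR e (fun y => c * a y) x = c * pdR e a x := by
  rw [pdR_mul contDiff_const ha, pdR_const]
  ring

lemma pdR_exp (ha : ContDiff ℝ (⊤ : ℕ∞) a) (e x : Surf) :
    pdR e (fun y => Real.exp (2 * a y)) x = 2 * pdR e a x * Real.exp (2 * a x) := by
  rw [pdR, fderiv_exp ((contDiff_const.mul ha).differentiable (by simp) x)]
  rw [smul_apply, smul_eq_mul, mul_comm]
  congr 1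
  exact pdR_const_mul 2 ha e x

lemma pd_add (hf : ContDiff ℝ (⊤ : ℕ∞) f) (hg : ContDiff ℝ (⊤ : ℕ∞) g) (e x : Surf) :
    pd e (fun y => f y + g y) x = pd e f x + pd e g x := by
  rw [pd, fderiv_fun_add (hf.differentiable (by simp) x) (hg.differentiable (by simp) x)]
  rfl

lemma pd_smul (ha : ContDiff ℝ (⊤ : ℕ∞) a) (hf : ContDiff ℝ (⊤ : ℕ∞) f) (e x : Surf) :
    pd e (fun y => a y • f y) x = pdR e a x • f x + a x • pd e f x := by
  rw [pd, fderiv_fun_smul (ha.differentiable (by simp) x) (hf.differentiable (by simp) x)]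
  simp [pdR, pd, add_comm]

lemma pd_const (z : MV n) (e x : Surf) : pd e (fun _ => z) x = 0 := by simp [pd]

lemma mink_pd_add_mink_pd_eq_zero {c : ℝ} (hf : ContDiff ℝ (⊤ : ℕ∞) f)
    (hg : ContDiff ℝ (⊤ : ℕ∞) g) (h : ∀ x, mink n (f x) (g x) = c) (e x : Surf) :
    mink n (pd e f x) (g x) + mink n (f x) (pd e g x) = 0 := by
  rw [← pdR_mink hf hg, funext h, pdR_const]

lemma mink_pd_eq_zero {c : ℝ} {z : MV n} (hf : ContDiff ℝ (⊤ : ℕ∞) f)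
    (h : ∀ x, mink n (f x) z = c) (e x : Surf) : mink n (pd e f x) z = 0 := by
  simpa [pd_const, mink_zero_right] using
    mink_pd_add_mink_pd_eq_zero hf (contDiff_const (c := z)) h e x

end PartialDerivatives

/-- `F : Σ → E(w)` is a surface with unit normal `N`, first fundamental form
`e^{2θ}(du² + dv²)` and second fundamental form `e^{2θ}(k₁du² + k₂dv²)`. -/
structure IsCurvatureLineSurface (F N : Surf → MV 3) (w : MV 3) (θ k₁ k₂ : Surf → ℝ) :
    Prop where
  smooth_F : ContDiff ℝ (⊤ : ℕ∞) F
  smooth_N : ContDiff ℝ (⊤ : ℕ∞) N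
  smooth_θ : ContDiff ℝ (⊤ : ℕ∞) θ
  smooth_k₁ : ContDiff ℝ (⊤ : ℕ∞) k₁
  smooth_k₂ : ContDiff ℝ (⊤ : ℕ∞) k₂
  F_F : ∀ x, mink 3 (F x) (F x) = 0
  F_w : ∀ x, mink 3 (F x) w = -1
  N_N : ∀ x, mink 3 (N x) (N x) = 1
  N_w : ∀ x, mink 3 (N x) w = 0
  N_F : ∀ x, mink 3 (N x) (F x) = 0
  N_Fu : ∀ x, mink 3 (N x) (pd du F x) = 0
  N_Fv : ∀ x, mink 3 (N x) (pd dv F x) = 0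
  Fu_Fu : ∀ x, mink 3 (pd du F x) (pd du F x) = Real.exp (2 * θ x)
  Fv_Fv : ∀ x, mink 3 (pd dv F x) (pd dv F x) = Real.exp (2 * θ x)
  Fu_Fv : ∀ x, mink 3 (pd du F x) (pd dv F x) = 0
  Fuu_N : ∀ x, mink 3 (pd du (pd du F) x) (N x) = Real.exp (2 * θ x) * k₁ x
  Fuv_N : ∀ x, mink 3 (pd du (pd dv F) x) (N x) = 0
  Fvv_N : ∀ x, mink 3 (pd dv (pd dv F) x) (N x) = Real.exp (2 * θ x) * k₂ x

namespace IsCurvatureLineSurface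

variable {F N : Surf → MV 3} {w : MV 3} {θ k₁ k₂ : Surf → ℝ}

section Structure

variable (h : IsCurvatureLineSurface F N w θ k₁ k₂)
include h

lemma smooth_Fu : ContDiff ℝ (⊤ : ℕ∞) (pd du F) := contDiff_pd h.smooth_F du

lemma smooth_Fv : ContDiff ℝ (⊤ : ℕ∞) (pd dv F) := contDiff_pd h.smooth_F dv

lemma smooth_exp : ContDiff ℝ (⊤ : ℕ∞) (fun x => Real.exp (2 * θ x)) :=
  Real.contDiff_exp.comp (contDiff_const.mul h.smooth_θ)

lemma smooth_H : ContDiff ℝ (⊤ : ℕ∞) (Hfun k₁ k₂) := (h.smooth_k₁.add h.smooth_k₂).div_const 2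

lemma smooth_L : ContDiff ℝ (⊤ : ℕ∞) (Lfun θ k₁ k₂) :=
  h.smooth_exp.mul (h.smooth_k₁.sub h.smooth_k₂)

lemma smooth_M : ContDiff ℝ (⊤ : ℕ∞) (Mfun θ k₁ k₂) := (h.smooth_H.mul h.smooth_L).neg

lemma F_pd (e x : Surf) : mink 3 (F x) (pd e F x) = 0 := by
  have := mink_pd_add_mink_pd_eq_zero h.smooth_F h.smooth_F h.F_F e x
  rw [mink_comm (pd e F x)] at this
  linarith

lemma frame (x : Surf) :
    IsAdaptedFrame (F x) (pd du F x) (pd dv F x) (N x) w (Real.exp (2 * θ x)) where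
  pos := Real.exp_pos _
  FF := h.F_F x
  FP := h.F_pd du x
  FQ := h.F_pd dv x
  FN := by rw [mink_comm, h.N_F]
  Fw := h.F_w x
  PP := h.Fu_Fu x
  PQ := h.Fu_Fv x
  PN := by rw [mink_comm, h.N_Fu]
  Pw := mink_pd_eq_zero h.smooth_F h.F_w du x
  QQ := h.Fv_Fv x
  QN := by rw [mink_comm, h.N_Fv]
  Qw := mink_pd_eq_zero h.smooth_F h.F_w dv x
  NN := h.N_N x
  Nw := h.N_w x

lemma Fuv_comm (x : Surf) : pd dv (pd du F) x = pd du (pd dv F) x :=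
  fderiv_fderiv_comm h.smooth_F du dv x

lemma Fuv_eq (x : Surf) :
    pd du (pd dv F) x = pdR dv θ x • pd du F x + pdR du θ x • pd dv F x := by
  have f := h.frame x
  have hF := mink_pd_add_mink_pd_eq_zero h.smooth_Fv h.smooth_F
    (fun y => (h.frame y).QF) du x
  have hu := pdR_mink h.smooth_Fu h.smooth_Fu dv x
  have hv := pdR_mink h.smooth_Fv h.smooth_Fv du x
  rw [funext h.Fu_Fu, pdR_exp h.smooth_θ, h.Fuv_comm,
    mink_comm (pd du F x) (pd du (pd dv F) x)] at hu
  rw [funext h.Fv_Fv, pdR_exp h.smooth_θ, mink_comm (pd dv F x) (pd du (pd dv F) x)] at hv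
  rw [f.QP] at hF
  have hw := mink_pd_eq_zero h.smooth_Fv (fun y => (h.frame y).Qw) du x
  apply f.eq_of_mink_eq <;> simp only [mink_add_left, mink_smul_left, h.Fuv_N, f.PF, f.PP, f.PQ,
    f.PN, f.Pw, f.QF, f.QP, f.QQ, f.QN, f.Qw, hw] <;> linarith

lemma Nu_eq (x : Surf) : pd du N x = (-k₁ x) • pd du F x := by
  have f := h.frame x
  have hF := mink_pd_add_mink_pd_eq_zero h.smooth_N h.smooth_F h.N_F du x
  have hu := mink_pd_add_mink_pd_eq_zero h.smooth_N h.smooth_Fu h.N_Fu du x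
  have hv := mink_pd_add_mink_pd_eq_zero h.smooth_N h.smooth_Fv h.N_Fv du x
  have hN := mink_pd_add_mink_pd_eq_zero h.smooth_N h.smooth_N h.N_N du x
  have hw := mink_pd_eq_zero h.smooth_N h.N_w du x
  rw [f.NP] at hF
  rw [mink_comm (N x), h.Fuu_N] at hu
  rw [mink_comm (N x), h.Fuv_N] at hv
  rw [mink_comm (N x)] at hN
  apply f.eq_of_mink_eq <;> simp only [mink_smul_left, f.PF, f.PP, f.PQ, f.PN, f.Pw] <;> linarith

lemma Nv_eq (x : Surf) : pd dv N x = (-k₂ x) • pd dv F x := by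
  have f := h.frame x
  have hF := mink_pd_add_mink_pd_eq_zero h.smooth_N h.smooth_F h.N_F dv x
  have hu := mink_pd_add_mink_pd_eq_zero h.smooth_N h.smooth_Fu h.N_Fu dv x
  have hv := mink_pd_add_mink_pd_eq_zero h.smooth_N h.smooth_Fv h.N_Fv dv x
  have hN := mink_pd_add_mink_pd_eq_zero h.smooth_N h.smooth_N h.N_N dv x
  have hw := mink_pd_eq_zero h.smooth_N h.N_w dv x
  rw [f.NQ] at hF
  rw [mink_comm (N x), h.Fvv_N] at hv
  rw [mink_comm (N x), h.Fuv_comm, h.Fuv_N] at hu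
  rw [mink_comm (N x)] at hN
  apply f.eq_of_mink_eq <;> simp only [mink_smul_left, f.QF, f.QQ, f.QP, f.QN, f.Qw] <;> linarith

/-- The Codazzi equations. -/
lemma codazzi (x : Surf) :
    pdR dv k₁ x = (k₂ x - k₁ x) * pdR dv θ x ∧ pdR du k₂ x = (k₁ x - k₂ x) * pdR du θ x := by
  have f := h.frame x
  have hE := f.pos.ne'
  have hcomm : pd dv (pd du N) x = pd du (pd dv N) x := fderiv_fderiv_comm h.smooth_N du dv x
  have pdR_neg : ∀ (k : Surf → ℝ) (e : Surf), pdR e (fun y => -k y) x = -pdR e k x := by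
    intro k e
    rw [pdR, fderiv_fun_neg]
    rfl
  rw [funext h.Nu_eq, funext h.Nv_eq, pd_smul h.smooth_k₁.neg h.smooth_Fu,
    pd_smul h.smooth_k₂.neg h.smooth_Fv, h.Fuv_comm, h.Fuv_eq, pdR_neg, pdR_neg] at hcomm
  have hu := congrArg (fun z => mink 3 z (pd du F x)) hcomm
  have hv := congrArg (fun z => mink 3 z (pd dv F x)) hcomm
  simp only [mink_add_left, mink_smul_left, f.PP, f.PQ, f.QP, f.QQ] at hu hv
  constructor <;> apply mul_right_cancel₀ hE <;> linarith

lemma pdR_H (e x : Surf) : pdR e (Hfun k₁ k₂) x = (pdR e k₁ x + pdR e k₂ x) / 2 := by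
  have : Hfun k₁ k₂ = fun y => (1 / 2) * (k₁ y + k₂ y) := by
    funext y
    simp only [Hfun]
    ring
  rw [this, pdR_const_mul _ (h.smooth_k₁.add h.smooth_k₂), pdR_add h.smooth_k₁ h.smooth_k₂]
  ring

lemma pdR_L (e x : Surf) : pdR e (Lfun θ k₁ k₂) x
    = Real.exp (2 * θ x) * (2 * pdR e θ x * (k₁ x - k₂ x) + (pdR e k₁ x - pdR e k₂ x)) := by
  unfold Lfun
  rw [pdR_mul h.smooth_exp (h.smooth_k₁.sub h.smooth_k₂), pdR_sub h.smooth_k₁ h.smooth_k₂,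
    pdR_exp h.smooth_θ]
  ring

lemma Lu_eq (x : Surf) :
    pdR du (Lfun θ k₁ k₂) x = 2 * Real.exp (2 * θ x) * pdR du (Hfun k₁ k₂) x := by
  rw [h.pdR_L, h.pdR_H, (h.codazzi x).2]
  ring

lemma Lv_eq (x : Surf) :
    pdR dv (Lfun θ k₁ k₂) x = -(2 * Real.exp (2 * θ x) * pdR dv (Hfun k₁ k₂) x) := by
  rw [h.pdR_L, h.pdR_H, (h.codazzi x).1]
  ring

lemma pdR_M (e x : Surf) : pdR e (Mfun θ k₁ k₂) x
    = -(pdR e (Hfun k₁ k₂) x * Lfun θ k₁ k₂ x + Hfun k₁ k₂ x * pdR e (Lfun θ k₁ k₂) x) := by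
  have : Mfun θ k₁ k₂ = fun y => (-1) * (Hfun k₁ k₂ y * Lfun θ k₁ k₂ y) := by
    funext y
    simp only [Mfun]
    ring
  rw [this, pdR_const_mul _ (h.smooth_H.mul h.smooth_L), pdR_mul h.smooth_H h.smooth_L]
  ring

lemma Mu_eq (x : Surf) :
    pdR du (Mfun θ k₁ k₂) x = -(2 * Real.exp (2 * θ x) * k₁ x * pdR du (Hfun k₁ k₂) x) := by
  rw [h.pdR_M, h.Lu_eq]
  simp only [Hfun, Lfun]
  ring

lemma Mv_eq (x : Surf) :
    pdR dv (Mfun θ k₁ k₂) x = 2 * Real.exp (2 * θ x) * k₂ x * pdR dv (Hfun k₁ k₂) x := by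
  rw [h.pdR_M, h.Lv_eq]
  simp only [Hfun, Lfun]
  ring

lemma Huv_comm (x : Surf) :
    pdR dv (pdR du (Hfun k₁ k₂)) x = pdR du (pdR dv (Hfun k₁ k₂)) x :=
  fderiv_fderiv_comm h.smooth_H du dv x

lemma Huv_eq (x : Surf) : pdR du (pdR dv (Hfun k₁ k₂)) x
    = -(pdR du θ x * pdR dv (Hfun k₁ k₂) x + pdR dv θ x * pdR du (Hfun k₁ k₂) x) := by
  have hcomm : pdR dv (pdR du (Lfun θ k₁ k₂)) x = pdR du (pdR dv (Lfun θ k₁ k₂)) x :=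
    fderiv_fderiv_comm h.smooth_L du dv x
  have hu : pdR du (Lfun θ k₁ k₂) =
      fun y => 2 * (Real.exp (2 * θ y) * pdR du (Hfun k₁ k₂) y) := by
    funext y
    rw [h.Lu_eq, mul_assoc]
  have hv : pdR dv (Lfun θ k₁ k₂) =
      fun y => (-2) * (Real.exp (2 * θ y) * pdR dv (Hfun k₁ k₂) y) := by
    funext y
    rw [h.Lv_eq]
    ring
  have sHu := contDiff_pdR h.smooth_H du
  have sHv := contDiff_pdR h.smooth_H dv
  rw [hu, hv, pdR_const_mul _ (h.smooth_exp.mul sHu), pdR_const_mul _ (h.smooth_exp.mul sHv),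
    pdR_mul h.smooth_exp sHu, pdR_mul h.smooth_exp sHv, pdR_exp h.smooth_θ, pdR_exp h.smooth_θ,
    h.Huv_comm] at hcomm
  apply mul_right_cancel₀ (h.frame x).pos.ne'
  linarith

end Structure

/-- The components of `d p₁ + η(c w) = 0`, `d p₂ + η p₁ = 0` and `η p₂ = 0`, which say that
`c w + t p₁ + t² p₂` is a conserved quantity of `d + tη` for
`η = e^{-2θ} F ∧ (-F_u du + F_v dv)`. -/
structure IsQuadraticConservedQuantity (F : Surf → MV 3) (θ : Surf → ℝ) (c : ℝ)
    (p₁ p₂ : Surf → MV 3) : Prop where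
  smooth_p₁ : ContDiff ℝ (⊤ : ℕ∞) p₁
  smooth_p₂ : ContDiff ℝ (⊤ : ℕ∞) p₂
  p₁u : ∀ x, pd du p₁ x = (-(c / Real.exp (2 * θ x))) • pd du F x
  p₁v : ∀ x, pd dv p₁ x = (c / Real.exp (2 * θ x)) • pd dv F x
  p₂u : ∀ x, pd du p₂ x = (mink 3 (p₁ x) (F x) / Real.exp (2 * θ x)) • pd du F x
    + (-(mink 3 (p₁ x) (pd du F x) / Real.exp (2 * θ x))) • F x
  p₂v : ∀ x, pd dv p₂ x = (-(mink 3 (p₁ x) (F x) / Real.exp (2 * θ x))) • pd dv F x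
    + (mink 3 (p₁ x) (pd dv F x) / Real.exp (2 * θ x)) • F x
  p₂_F : ∀ x, mink 3 (p₂ x) (F x) = 0
  p₂_Fu : ∀ x, mink 3 (p₂ x) (pd du F x) = 0
  p₂_Fv : ∀ x, mink 3 (p₂ x) (pd dv F x) = 0

section DarbouxBianchi

variable (h : IsCurvatureLineSurface F N w θ k₁ k₂)
include h

lemma exists_darbouxBianchi {c : ℝ} {p₁ p₂ : Surf → MV 3}
    (q : IsQuadraticConservedQuantity F θ c p₁ p₂) (hp₂ : p₂ ≠ 0) :
    ∃ A B C D : ℝ, DarbouxBianchi w θ k₁ k₂ A B C D := by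
  obtain ⟨b, hb⟩ : ∃ b, ∀ x, mink 3 (p₂ x) (N x) = b := by
    refine eq_const_of_fderiv_du_dv_eq_zero (q.smooth_p₂.mink h.smooth_N) (fun x => ?_)
      fun x => ?_
    · have f := h.frame x
      rw [pdR_mink q.smooth_p₂ h.smooth_N, h.Nu_eq, q.p₂u]
      simp only [mink_add_left, mink_smul_left, mink_smul_right, q.p₂_Fu, f.PN, f.FN, mul_zero,
        add_zero]
    · have f := h.frame x
      rw [pdR_mink q.smooth_p₂ h.smooth_N, h.Nv_eq, q.p₂v]
      simp only [mink_add_left, mink_smul_left, mink_smul_right, q.p₂_Fv, f.QN, f.FN, mul_zero,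
        add_zero]
  have hp₂_eq : ∀ x, p₂ x = (-mink 3 (p₂ x) w) • F x + b • N x := by
    intro x
    have := (h.frame x).expansion (p₂ x)
    simpa [q.p₂_F, q.p₂_Fu, q.p₂_Fv, hb] using this
  have hsys : ∀ x, mink 3 (p₂ x) w = -(b * Hfun k₁ k₂ x) ∧
      mink 3 (p₁ x) (F x) = -(b * Lfun θ k₁ k₂ x / 2) := by
    intro x
    have f := h.frame x
    have hE := f.pos.ne'
    have hu := mink_pd_add_mink_pd_eq_zero q.smooth_p₂ h.smooth_Fu q.p₂_Fu du x
    have hv := mink_pd_add_mink_pd_eq_zero q.smooth_p₂ h.smooth_Fv q.p₂_Fv dv x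
    have hFu := mink_pd_add_mink_pd_eq_zero h.smooth_F h.smooth_Fu (h.F_pd du) du x
    have hFv := mink_pd_add_mink_pd_eq_zero h.smooth_F h.smooth_Fv (h.F_pd dv) dv x
    have hNu := h.Fuu_N x
    have hNv := h.Fvv_N x
    rw [mink_comm] at hNu hNv
    rw [q.p₂u, hp₂_eq] at hu
    rw [q.p₂v, hp₂_eq] at hv
    simp only [mink_add_left, mink_smul_left, f.PP, f.QQ, f.FP, f.FQ, hNu, hNv] at hu hv hFu hFv
    rw [eq_neg_of_add_eq_zero_right hFu, div_mul_cancel₀ _ hE] at hu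
    rw [eq_neg_of_add_eq_zero_right hFv, neg_mul, div_mul_cancel₀ _ hE] at hv
    constructor
    · apply mul_right_cancel₀ hE
      simp only [Hfun]
      linarith
    · simp only [Lfun]
      linarith
  have hbne : b ≠ 0 := by
    rintro rfl
    refine hp₂ (funext fun x => ?_)
    rw [hp₂_eq, (hsys x).1]
    simp
  have hw_deriv : ∀ e x, mink 3 (pd e p₂ x) w = -(b * pdR e (Hfun k₁ k₂) x) := by
    intro e x
    have := pdR_mink q.smooth_p₂ (contDiff_const (c := w)) e x
    rw [pd_const, mink_zero_right, add_zero] at this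
    rw [← this, funext fun y => (hsys y).1, ← neg_mul, ← pdR_const_mul _ h.smooth_H]
    simp only [neg_mul]
  have hPu : ∀ x, mink 3 (p₁ x) (pd du F x)
      = -(Real.exp (2 * θ x) * b * pdR du (Hfun k₁ k₂) x) := by
    intro x
    have f := h.frame x
    have := hw_deriv du x
    rw [q.p₂u] at this
    simp only [mink_add_left, mink_smul_left, f.Pw, f.Fw] at this
    have hE := f.pos.ne'
    field_simp at this
    linarith
  have hPv : ∀ x, mink 3 (p₁ x) (pd dv F x)
      = Real.exp (2 * θ x) * b * pdR dv (Hfun k₁ k₂) x := by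
    intro x
    have f := h.frame x
    have := hw_deriv dv x
    rw [q.p₂v] at this
    simp only [mink_add_left, mink_smul_left, f.Qw, f.Fw] at this
    have hE := f.pos.ne'
    field_simp at this
    linarith
  have sN := q.smooth_p₁.mink h.smooth_N
  have sp := q.smooth_p₁.mink q.smooth_p₁
  obtain ⟨n₀, hn₀⟩ : ∃ n₀, ∀ x, mink 3 (p₁ x) (N x) + b / 2 * Mfun θ k₁ k₂ x = n₀ := by
    refine eq_const_of_fderiv_du_dv_eq_zero (sN.add (contDiff_const.mul h.smooth_M))
      (fun x => ?_) fun x => ?_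
    · rw [pdR_add sN (contDiff_const.mul h.smooth_M), pdR_const_mul _ h.smooth_M,
        pdR_mink q.smooth_p₁ h.smooth_N, h.Nu_eq, q.p₁u, h.Mu_eq, mink_smul_left,
        mink_smul_right, (h.frame x).PN, hPu]
      ring
    · rw [pdR_add sN (contDiff_const.mul h.smooth_M), pdR_const_mul _ h.smooth_M,
        pdR_mink q.smooth_p₁ h.smooth_N, h.Nv_eq, q.p₁v, h.Mv_eq, mink_smul_left,
        mink_smul_right, (h.frame x).QN, hPv]
      ring
  obtain ⟨q₀, hq₀⟩ : ∃ q₀, ∀ x, mink 3 (p₁ x) w = q₀ := by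
    refine eq_const_of_fderiv_du_dv_eq_zero (q.smooth_p₁.mink contDiff_const)
      (fun x => ?_) fun x => ?_
    · rw [pdR_mink q.smooth_p₁ contDiff_const, q.p₁u, pd_const, mink_smul_left,
        mink_zero_right, (h.frame x).Pw]
      ring
    · rw [pdR_mink q.smooth_p₁ contDiff_const, q.p₁v, pd_const, mink_smul_left,
        mink_zero_right, (h.frame x).Qw]
      ring
  obtain ⟨s₀, hs₀⟩ : ∃ s₀, ∀ x,
      mink 3 (p₁ x) (p₁ x) + -(2 * c * b) * Hfun k₁ k₂ x = s₀ := by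
    refine eq_const_of_fderiv_du_dv_eq_zero (sp.add (contDiff_const.mul h.smooth_H))
      (fun x => ?_) fun x => ?_
    · have hE := (h.frame x).pos.ne'
      rw [pdR_add sp (contDiff_const.mul h.smooth_H), pdR_const_mul _ h.smooth_H,
        pdR_mink q.smooth_p₁ q.smooth_p₁, q.p₁u, mink_smul_left, mink_smul_right,
        mink_comm _ (p₁ x), hPu]
      field_simp
      ring
    · have hE := (h.frame x).pos.ne'
      rw [pdR_add sp (contDiff_const.mul h.smooth_H), pdR_const_mul _ h.smooth_H,
        pdR_mink q.smooth_p₁ q.smooth_p₁, q.p₁v, mink_smul_left, mink_smul_right,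
        mink_comm _ (p₁ x), hPv]
      field_simp
      ring
  refine ⟨-n₀ / b, c / b, q₀ / b, (n₀ ^ 2 - s₀) / b ^ 2, fun x => ?_⟩
  have f := h.frame x
  have hE := f.pos.ne'
  have key := f.mink_self (p₁ x)
  rw [eq_sub_of_add_eq (hn₀ x), eq_sub_of_add_eq (hs₀ x), hPu, hPv, (hsys x).2, hq₀] at key
  field_simp at key ⊢
  linarith

lemma exists_quadraticConservedQuantity {A B C D : ℝ}
    (hH : ∀ x, pdR du (Hfun k₁ k₂) x * pdR dv (Hfun k₁ k₂) x ≠ 0)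
    (hDB : DarbouxBianchi w θ k₁ k₂ A B C D) :
    ∃ p₁ p₂ : Surf → MV 3, IsQuadraticConservedQuantity F θ B p₁ p₂ ∧ p₂ ≠ 0 := by
  set H := Hfun k₁ k₂ with hHdef
  set L := Lfun θ k₁ k₂ with hLdef
  set M := Mfun θ k₁ k₂
  have sH : ContDiff ℝ (⊤ : ℕ∞) H := h.smooth_H
  have sL : ContDiff ℝ (⊤ : ℕ∞) L := h.smooth_L
  have sM : ContDiff ℝ (⊤ : ℕ∞) M := h.smooth_M
  have sHu := contDiff_pdR sH du
  have sHv := contDiff_pdR sH dv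
  obtain ⟨p₁, sp₁, hF, hu, hv, hN, hw⟩ : ∃ p₁ : Surf → MV 3, ContDiff ℝ (⊤ : ℕ∞) p₁ ∧
      (∀ x, mink 3 (p₁ x) (F x) = -1 / 2 * L x) ∧
      (∀ x, mink 3 (p₁ x) (pd du F x) = -1 * (Real.exp (2 * θ x) * pdR du H x)) ∧
      (∀ x, mink 3 (p₁ x) (pd dv F x) = Real.exp (2 * θ x) * pdR dv H x) ∧
      (∀ x, mink 3 (p₁ x) (N x) = -1 / 2 * M x + -A) ∧ ∀ x, mink 3 (p₁ x) w = C := by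
    refine ⟨fun x => (-C + mink 3 w w * L x / 2) • F x + (-pdR du H x) • pd du F x
      + pdR dv H x • pd dv F x + (-1 / 2 * M x + -A) • N x + (L x / 2) • w, ?_, ?_, ?_, ?_, ?_, ?_⟩
    · exact (((((contDiff_const.add ((contDiff_const.mul sL).div_const 2)).smul
        h.smooth_F).add (sHu.neg.smul h.smooth_Fu)).add (sHv.smul h.smooth_Fv)).add
        (((contDiff_const.mul sM).add contDiff_const).smul h.smooth_N)).add
        ((sL.div_const 2).smul contDiff_const)
    all_goals
      intro x
      have f := h.frame x
      simp only [mink_add_left, mink_smul_left, f.FF, f.FP, f.FQ, f.FN, f.Fw, f.PF, f.PP, f.PQ,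
        f.PN, f.Pw, f.QF, f.QP, f.QQ, f.QN, f.Qw, f.NF, f.NP, f.NQ, f.NN, f.Nw, f.wF, f.wP,
        f.wQ, f.wN]
      ring
  have hself : ∀ x, mink 3 (p₁ x) (p₁ x) = 2 * B * H x + (A ^ 2 - D) := by
    intro x
    have f := h.frame x
    have hE := f.pos.ne'
    have hdb := hDB x
    rw [f.mink_self, hF, hu, hv, hN, hw]
    field_simp at hdb ⊢
    linarith
  have hself_deriv : ∀ e x, mink 3 (pd e p₁ x) (p₁ x) = B * pdR e H x := by
    intro e x
    have := pdR_mink sp₁ sp₁ e x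
    rw [funext hself, pdR_add (contDiff_const.mul sH) contDiff_const, pdR_const_mul _ sH,
      pdR_const, mink_comm (p₁ x)] at this
    linarith
  have hFe : ∀ e x, mink 3 (pd e p₁ x) (F x) + mink 3 (p₁ x) (pd e F x) = -1 / 2 * pdR e L x := by
    intro e x
    rw [← pdR_mink sp₁ h.smooth_F, funext hF, pdR_const_mul _ sL]
  have hNe : ∀ e x, mink 3 (pd e p₁ x) (N x) + mink 3 (p₁ x) (pd e N x) = -1 / 2 * pdR e M x := by
    intro e x
    rw [← pdR_mink sp₁ h.smooth_N, funext hN, pdR_add (contDiff_const.mul sM) contDiff_const,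
      pdR_const_mul _ sM, pdR_const, add_zero]
  have hwe := fun e x => mink_pd_eq_zero sp₁ hw e x
  have hp₁Fuv : ∀ x, mink 3 (p₁ x) (pd du (pd dv F) x)
      = Real.exp (2 * θ x) * (pdR du θ x * pdR dv H x - pdR dv θ x * pdR du H x) := by
    intro x
    rw [h.Fuv_eq, mink_add_right, mink_smul_right, mink_smul_right, hu, hv]
    ring
  have hp₁u : ∀ x, pd du p₁ x = (-(B / Real.exp (2 * θ x))) • pd du F x := by
    intro x
    have f := h.frame x
    have hE := f.pos.ne'
    have hv_deriv := pdR_mink sp₁ h.smooth_Fv du x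
    rw [funext hv, pdR_mul h.smooth_exp sHv, pdR_exp h.smooth_θ, h.Huv_eq, hp₁Fuv] at hv_deriv
    have eF : mink 3 (pd du p₁ x) (F x) = 0 := by
      have := hFe du x
      rw [hu, h.Lu_eq] at this
      linarith
    have eN : mink 3 (pd du p₁ x) (N x) = 0 := by
      have := hNe du x
      rw [h.Nu_eq, mink_smul_right, hu, h.Mu_eq] at this
      linarith
    have eQ : mink 3 (pd du p₁ x) (pd dv F x) = 0 := by linarith
    have hexp := f.expansion (pd du p₁ x)
    simp only [eF, eN, eQ, hwe, mul_zero, add_zero, neg_zero, zero_smul, zero_add, zero_div]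
      at hexp
    have hρ := congrArg (fun z => mink 3 z (p₁ x)) hexp
    simp only [hself_deriv, mink_comm _ (p₁ x), mink_smul_right, hu] at hρ
    rw [hexp]
    congr 1
    apply mul_right_cancel₀ (mul_ne_zero hE (left_ne_zero_of_mul (hH x)))
    field_simp at hρ ⊢
    linarith
  have hp₁v : ∀ x, pd dv p₁ x = (B / Real.exp (2 * θ x)) • pd dv F x := by
    intro x
    have f := h.frame x
    have hE := f.pos.ne'
    have hu_deriv := pdR_mink sp₁ h.smooth_Fu dv x
    rw [funext hu, pdR_const_mul _ (h.smooth_exp.mul sHu), pdR_mul h.smooth_exp sHu,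
      pdR_exp h.smooth_θ, h.Huv_comm, h.Huv_eq, h.Fuv_comm, hp₁Fuv] at hu_deriv
    have eF : mink 3 (pd dv p₁ x) (F x) = 0 := by
      have := hFe dv x
      rw [hv, h.Lv_eq] at this
      linarith
    have eN : mink 3 (pd dv p₁ x) (N x) = 0 := by
      have := hNe dv x
      rw [h.Nv_eq, mink_smul_right, hv, h.Mv_eq] at this
      linarith
    have eP : mink 3 (pd dv p₁ x) (pd du F x) = 0 := by linarith
    have hexp := f.expansion (pd dv p₁ x)
    simp only [eF, eN, eP, hwe, mul_zero, add_zero, neg_zero, zero_smul, zero_add, zero_div]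
      at hexp
    have hρ := congrArg (fun z => mink 3 z (p₁ x)) hexp
    simp only [hself_deriv, mink_comm _ (p₁ x), mink_smul_right, hv] at hρ
    rw [hexp]
    congr 1
    apply mul_right_cancel₀ (mul_ne_zero hE (right_ne_zero_of_mul (hH x)))
    field_simp at hρ ⊢
    linarith
  have sHF : ContDiff ℝ (⊤ : ℕ∞) (fun x => H x • F x) := sH.smul h.smooth_F
  refine ⟨p₁, fun x => H x • F x + N x,
    ⟨sp₁, sHF.add h.smooth_N, hp₁u, hp₁v, fun x => ?_, fun x => ?_, fun x => ?_, fun x => ?_,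
      fun x => ?_⟩, fun h0 => ?_⟩
  · have hE := (h.frame x).pos.ne'
    rw [pd_add sHF h.smooth_N, pd_smul sH h.smooth_F, h.Nu_eq, hF, hu, hHdef, hLdef]
    simp only [Hfun, Lfun]
    match_scalars <;> field_simp
    ring
  · have hE := (h.frame x).pos.ne'
    rw [pd_add sHF h.smooth_N, pd_smul sH h.smooth_F, h.Nv_eq, hF, hv, hHdef, hLdef]
    simp only [Hfun, Lfun]
    match_scalars <;> field_simp
    ring
  · simp [mink_add_left, mink_smul_left, h.F_F, h.N_F]
  · simp [mink_add_left, mink_smul_left, h.F_pd, h.N_Fu]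
  · simp [mink_add_left, mink_smul_left, h.F_pd, h.N_Fv]
  · have := congrArg (fun z => mink 3 z (N 0)) (congrFun h0 0)
    simp [mink_add_left, mink_smul_left, h.N_N, (h.frame 0).FN, mink_zero_left] at this

end DarbouxBianchi

end IsCurvatureLineSurface

section Pencil

variable {n : ℕ}

lemma wedge_smul_add (u v z z' : MV n) (t : ℝ) :
    wedge n u v (z + t • z') = wedge n u v z + t • wedge n u v z' := by
  simp only [wedge, mink_add_right, mink_smul_right]
  module

lemma pd_smul_add {f g : Surf → MV n} (hf : ContDiff ℝ (⊤ : ℕ∞) f)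
    (hg : ContDiff ℝ (⊤ : ℕ∞) g) (t : ℝ) (e x : Surf) :
    pd e (fun y => f y + t • g y) x = pd e f x + t • pd e g x := by
  have htg : ContDiff ℝ (⊤ : ℕ∞) (fun y => t • g y) := hg.const_smul t
  rw [pd_add hf htg, pd_smul contDiff_const hg, pdR_const]
  module

lemma sum_range_three_smul (t : ℝ) (p : ℕ → Surf → MV n) :
    (fun x => ∑ k ∈ Finset.range (2 + 1), t ^ k • p k x)
      = fun x => p 0 x + t • (p 1 x + t • p 2 x) := by
  funext x
  simp only [sum_range_succ, sum_range_zero]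
  module

/-- `(d + tη)(p₀ + t p₁ + t² p₂)` in a coordinate direction, expanded in powers of `t`. -/
lemma pencil_quadratic {p : ℕ → Surf → MV n} (hp : ∀ k, ContDiff ℝ (⊤ : ℕ∞) (p k))
    (u v : MV n) (t : ℝ) (e x : Surf) :
    pd e (fun x => ∑ k ∈ Finset.range (2 + 1), t ^ k • p k x) x
        + t • wedge n u v (∑ k ∈ Finset.range (2 + 1), t ^ k • p k x)
      = pd e (p 0) x + t • (pd e (p 1) x + wedge n u v (p 0 x))
        + t ^ 2 • (pd e (p 2) x + wedge n u v (p 1 x)) + t ^ 3 • wedge n u v (p 2 x) := by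
  have h₁₂ : ContDiff ℝ (⊤ : ℕ∞) (fun y => p 1 y + t • p 2 y) :=
    (hp 1).add ((hp 2).const_smul t)
  rw [congrFun (sum_range_three_smul t p) x, sum_range_three_smul, pd_smul_add (hp 0) h₁₂, pd_smul_add (hp 1) (hp 2),
    wedge_smul_add, wedge_smul_add]
  module

lemma parallelSection_quadratic_iff (S : IsothermicSurface n) {p : ℕ → Surf → MV n}
    (hp : ∀ k, ContDiff ℝ (⊤ : ℕ∞) (p k)) :
    (∀ t, ParallelSection n S t (fun x => ∑ k ∈ Finset.range (2 + 1), t ^ k • p k x)) ↔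
      ∀ x, (pd du (p 0) x = 0 ∧ pd du (p 1) x + wedge n (S.F x) (S.W₁ x) (p 0 x) = 0
          ∧ pd du (p 2) x + wedge n (S.F x) (S.W₁ x) (p 1 x) = 0
          ∧ wedge n (S.F x) (S.W₁ x) (p 2 x) = 0)
        ∧ pd dv (p 0) x = 0 ∧ pd dv (p 1) x + wedge n (S.F x) (S.W₂ x) (p 0 x) = 0
          ∧ pd dv (p 2) x + wedge n (S.F x) (S.W₂ x) (p 1 x) = 0
          ∧ wedge n (S.F x) (S.W₂ x) (p 2 x) = 0 := by
  refine ⟨fun h x => ⟨cubic_coeff_eq_zero fun t => ?_, cubic_coeff_eq_zero fun t => ?_⟩,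
    fun h t x => ?_⟩
  · rw [← pencil_quadratic hp]
    exact (h t x).1
  · rw [← pencil_quadratic hp]
    exact (h t x).2
  · obtain ⟨⟨hu₀, hu₁, hu₂, hu₃⟩, hv₀, hv₁, hv₂, hv₃⟩ := h x
    constructor
    · refine (pencil_quadratic hp _ _ t du x).trans ?_
      rw [hu₀, hu₁, hu₂, hu₃]
      simp
    · refine (pencil_quadratic hp _ _ t dv x).trans ?_
      rw [hv₀, hv₁, hv₂, hv₃]
      simp

end Pencil

section Isothermic

variable {S : IsothermicSurface 3} {N : Surf → MV 3} {w : MV 3} {θ k₁ k₂ : Surf → ℝ}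

lemma ConformalCoords.wedge_W₁ (hcc : ConformalCoords 3 S θ) (x : Surf) (z : MV 3) :
    wedge 3 (S.F x) (S.W₁ x) z = (-(mink 3 z (S.F x) / Real.exp (2 * θ x))) • pd du S.F x
      + (mink 3 z (pd du S.F x) / Real.exp (2 * θ x)) • S.F x := by
  rw [hcc.2.2.2.2.1, Real.exp_neg]
  simp only [wedge, mink_neg_left, mink_comm z]
  module

lemma ConformalCoords.wedge_W₂ (hcc : ConformalCoords 3 S θ) (x : Surf) (z : MV 3) :
    wedge 3 (S.F x) (S.W₂ x) z = (mink 3 z (S.F x) / Real.exp (2 * θ x)) • pd dv S.F x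
      + (-(mink 3 z (pd dv S.F x) / Real.exp (2 * θ x))) • S.F x := by
  rw [hcc.2.2.2.2.2, Real.exp_neg]
  simp only [wedge, mink_comm z]
  module

lemma parallelSection_quadratic_iff_isQuadraticConservedQuantity (hcc : ConformalCoords 3 S θ)
    (h : IsCurvatureLineSurface S.F N w θ k₁ k₂) {c : ℝ} {p : ℕ → Surf → MV 3}
    (hp : ∀ k, ContDiff ℝ (⊤ : ℕ∞) (p k)) (hp₀ : ∀ x, p 0 x = c • w) :
    (∀ t, ParallelSection 3 S t (fun x => ∑ k ∈ Finset.range (2 + 1), t ^ k • p k x)) ↔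
      IsCurvatureLineSurface.IsQuadraticConservedQuantity S.F θ c (p 1) (p 2) := by
  rw [parallelSection_quadratic_iff S hp]
  simp only [hcc.wedge_W₁, hcc.wedge_W₂]
  have hw₁ : ∀ x, (-(mink 3 (p 0 x) (S.F x) / Real.exp (2 * θ x))) • pd du S.F x
      + (mink 3 (p 0 x) (pd du S.F x) / Real.exp (2 * θ x)) • S.F x
        = (c / Real.exp (2 * θ x)) • pd du S.F x := by
    intro x
    rw [hp₀, mink_smul_left, mink_smul_left, (h.frame x).wF, (h.frame x).wP]
    module
  have hw₂ : ∀ x, (mink 3 (p 0 x) (S.F x) / Real.exp (2 * θ x)) • pd dv S.F x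
      + (-(mink 3 (p 0 x) (pd dv S.F x) / Real.exp (2 * θ x))) • S.F x
        = (-(c / Real.exp (2 * θ x))) • pd dv S.F x := by
    intro x
    rw [hp₀, mink_smul_left, mink_smul_left, (h.frame x).wF, (h.frame x).wQ]
    module
  simp only [hw₁, hw₂]
  constructor
  · intro H
    have hF : ∀ x, mink 3 (p 2 x) (S.F x) = 0 := by
      intro x
      have f := h.frame x
      have := congrArg (fun z => mink 3 z (pd du S.F x)) (H x).1.2.2.2
      simpa [mink_add_left, mink_smul_left, mink_zero_left, f.PP, f.FP, -neg_smul] using this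
    refine ⟨hp 1, hp 2, fun x => ?_, fun x => ?_, fun x => ?_, fun x => ?_, hF, fun x => ?_,
      fun x => ?_⟩
    · rw [eq_neg_of_add_eq_zero_left (H x).1.2.1]
      module
    · rw [eq_neg_of_add_eq_zero_left (H x).2.2.1]
      module
    · rw [eq_neg_of_add_eq_zero_left (H x).1.2.2.1]
      module
    · rw [eq_neg_of_add_eq_zero_left (H x).2.2.2.1]
      module
    · have f := h.frame x
      have := congrArg (fun z => mink 3 z w) (H x).1.2.2.2
      simpa [mink_add_left, mink_smul_left, mink_zero_left, f.Pw, f.Fw, -neg_smul] using this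
    · have f := h.frame x
      have := congrArg (fun z => mink 3 z w) (H x).2.2.2.2
      simpa [mink_add_left, mink_smul_left, mink_zero_left, f.Qw, f.Fw, -neg_smul] using this
  · intro q x
    have h₀ : ∀ e, pd e (p 0) x = 0 := by
      intro e
      rw [funext hp₀, pd_const]
    refine ⟨⟨h₀ du, ?_, ?_, ?_⟩, h₀ dv, ?_, ?_, ?_⟩
    · rw [q.p₁u]
      module
    · rw [q.p₂u]
      module
    · rw [q.p₂_F, q.p₂_Fu]
      module
    · rw [q.p₁v]
      module
    · rw [q.p₂v]
      module
    · rw [q.p₂_F, q.p₂_Fv]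
      module

end Isothermic

/-- A special isothermic surface of type `2` in `E(w)` satisfies the
Darboux–Bianchi condition for some constants `A,B,C,D`; conversely, if
`H_u H_v` never vanishes, the Darboux–Bianchi condition implies that the
surface is special isothermic of type `2` in `E(w)`. -/
theorem special_type_two_and_darboux_bianchi
    (S : IsothermicSurface 3) (w : MV 3) (hw : w ≠ 0)
    (hlift : ∀ x, mink 3 (S.F x) w = -1)
    (θ k₁ k₂ : Surf → ℝ) (hk₁ : ContDiff ℝ (⊤ : ℕ∞) k₁) (hk₂ : ContDiff ℝ (⊤ : ℕ∞) k₂)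
    (N : Surf → MV 3) (hNsm : ContDiff ℝ (⊤ : ℕ∞) N) (hN : IsUnitNormal 3 S.F N w)
    (hcc : ConformalCoords 3 S θ)
    (hpc : PrincipalCurvatures 3 S N θ k₁ k₂) :
    ((∃ p : PolyConservedQuantity 3 S 2, InSpaceForm p w) →
        ∃ A B C D : ℝ, DarbouxBianchi w θ k₁ k₂ A B C D)
    ∧ ((∀ x, pdR du (Hfun k₁ k₂) x * pdR dv (Hfun k₁ k₂) x ≠ 0) →
        (∃ A B C D : ℝ, DarbouxBianchi w θ k₁ k₂ A B C D) →
        ∃ p : PolyConservedQuantity 3 S 2, InSpaceForm p w) := by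
  have h : IsCurvatureLineSurface S.F N w θ k₁ k₂ :=
    ⟨S.smooth_F, hNsm, hcc.1, hk₁, hk₂, S.F_null, hlift, hN.1, hN.2.1, hN.2.2.1, hN.2.2.2.1,
      hN.2.2.2.2, hcc.2.1, hcc.2.2.1, hcc.2.2.2.1, hpc.1, hpc.2.1, hpc.2.2⟩
  constructor
  · rintro ⟨p, c, hc⟩
    exact h.exists_darbouxBianchi
      ((parallelSection_quadratic_iff_isQuadraticConservedQuantity hcc h p.smooth hc).mp
        p.conserved) p.top_ne
  · rintro hH ⟨A, B, C, D, hDB⟩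
    obtain ⟨p₁, p₂, q, hp₂⟩ := h.exists_quadraticConservedQuantity hH hDB
    let p : ℕ → Surf → MV 3
      | 0 => fun _ => B • w
      | 1 => p₁
      | 2 => p₂
      | _ => 0
    have hp : ∀ k, ContDiff ℝ (⊤ : ℕ∞) (p k)
      | 0 => contDiff_const
      | 1 => q.smooth_p₁
      | 2 => q.smooth_p₂
      | _ + 3 => contDiff_const
    have hzero : ∀ k, 2 < k → p k = 0
      | _ + 3, _ => rfl
    exact ⟨⟨p, hp, hzero, hp₂,
      (parallelSection_quadratic_iff_isQuadraticConservedQuantity hcc h hp fun _ => rfl).mpr q⟩,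
      B, fun _ => rfl⟩
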